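/- arXiv:2605.03524 — 4 statements merged into one kernel-verified Lean document; each statement's English description precedes it below -/
import Mathlib

section
/- Let G = (V, E) be a finite simple graph on n vertices whose vertex degrees, listed in non-increasing order, are d₁ ≥ d₂ ≥ ⋯ ≥ d_n. Then χ(G) ≤ max over i ∈ {1, …, n} of min(d_i + 1, i) (the Welsh–Powell bound). -/
/-- Greedy coloring: if every vertex has fewer than `k` neighbors preceding it in a well-order,
then the graph is `k`-colorable. -/
theorem SimpleGraph.colorable_of_encard_lt {W : Type*} [LinearOrder W] [WellFoundedLT W]
    (H : SimpleGraph W) (k : ℕ) (hk : ∀ v, {w | H.Adj v w ∧ w < v}.encard < k) :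
    H.Colorable k := by
  have free_color : ∀ (v : W) (c : ∀ w, w < v → Fin k),
      ∃ a, ∀ w (hw : w < v), H.Adj v w → c w hw ≠ a := by
    intro v c
    let used : Set (Fin k) :=
      (fun w : {w | H.Adj v w ∧ w < v} => c w.1 w.2.2) '' Set.univ
    have hused : used.encard < k := by
      refine (Set.encard_image_le _ _).trans_lt ?_
      simpa only [Set.encard_univ, ← Set.encard.eq_1] using hk v
    have hne : used ≠ Set.univ := by
      intro h
      simp [h] at hused
    obtain ⟨a, ha⟩ := (Set.ne_univ_iff_exists_notMem used).1 hne
    exact ⟨a, fun w hw hadj h => ha ⟨⟨w, hadj, hw⟩, Set.mem_univ _, h⟩⟩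
  choose next hnext using free_color
  let color : W → Fin k := wellFounded_lt.fix next
  have color_ne : ∀ v w, w < v → H.Adj v w → color w ≠ color v := by
    intro v w hw hadj
    have hv : color v = next v fun u _ => color u := wellFounded_lt.fix_eq next v
    rw [hv]
    exact hnext v (fun u _ => color u) w hw hadj
  refine ⟨SimpleGraph.Coloring.mk color fun {v w} hadj => ?_⟩
  rcases lt_or_gt_of_ne hadj.ne with h | h
  · exact color_ne w v h hadj.symm
  · exact (color_ne v w h hadj).symm

/-- Welsh–Powell bound: if the degrees of a finite simple graph `G` on `n`
vertices, listed in non-increasing order via an enumeration `e` of the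
vertices, are `d₁ ≥ d₂ ≥ ⋯ ≥ d_n`, then
`χ(G) ≤ max_{i ∈ {1,…,n}} min(dᵢ + 1, i)`.
(Here the vertex of 1-based rank `i` is `e ⟨i-1, _⟩`.) -/
theorem welsh_powell_bound
    {V : Type*} [Fintype V] (G : SimpleGraph V) [DecidableRel G.Adj]
    (n : ℕ) (hn : Fintype.card V = n) (e : Fin n ≃ V)
    (hsorted : ∀ i j : Fin n, i ≤ j → G.degree (e j) ≤ G.degree (e i)) :
    G.chromaticNumber ≤
      ((Finset.univ.sup fun i : Fin n =>
        min (G.degree (e i) + 1) (i.1 + 1) : ℕ) : ℕ∞) := by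
  rw [SimpleGraph.chromaticNumber_le_iff_colorable]
  refine SimpleGraph.Colorable.of_hom (SimpleGraph.Iso.comap e G).symm.toHom
    (SimpleGraph.colorable_of_encard_lt (G.comap e) _ fun i => ?_)
  have hdeg : {j | (G.comap e).Adj i j ∧ j < i}.encard ≤ G.degree (e i) := by
    rw [← e.injective.encard_image, ← SimpleGraph.card_neighborFinset_eq_degree,
      ← Set.encard_coe_eq_coe_finsetCard]
    refine Set.encard_le_encard ?_
    rintro _ ⟨j, ⟨hj, -⟩, rfl⟩
    simpa using hj
  have hidx : {j | (G.comap e).Adj i j ∧ j < i}.encard ≤ i.1 := by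
    rw [← Fin.card_Iio i, ← Set.encard_coe_eq_coe_finsetCard]
    refine Set.encard_le_encard fun j hj => ?_
    simpa using hj.2
  have hlt : min (G.degree (e i)) i.1 <
      Finset.univ.sup fun i : Fin n => min (G.degree (e i) + 1) (i.1 + 1) := by
    refine lt_of_lt_of_le ?_ (Finset.le_sup (Finset.mem_univ i))
    omega
  refine lt_of_le_of_lt ?_ (Nat.cast_lt.2 hlt)
  rcases min_choice (G.degree (e i)) i.1 with h | h <;> rw [h]
  exacts [hdeg, hidx]
end

section
/- Let G be a finite simple graph on n ≥ 2 vertices with at least one edge, let A be its adjacency matrix, and let λ₁ ≥ λ₂ ≥ ⋯ ≥ λ_n be the eigenvalues of A. Then χ(G) ≥ 1 − λ₁/λ_n (Hoffman's bound); note that λ_n < 0 since G has an edge. -/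
open Matrix in
/-- The Rayleigh quotient of a real symmetric matrix is at least any lower bound of its
eigenvalues. -/
theorem Matrix.IsHermitian.mul_dotProduct_le_of_le_eigenvalues {V : Type*} [Fintype V]
    [DecidableEq V] {A : Matrix V V ℝ} (hA : A.IsHermitian) {l : ℝ}
    (hl : ∀ i, l ≤ hA.eigenvalues i) (x : V → ℝ) :
    l * (x ⬝ᵥ x) ≤ x ⬝ᵥ A *ᵥ x := by
  have hB : (A - algebraMap ℝ (Matrix V V ℝ) l).IsHermitian :=
    hA.sub (by simp [Matrix.algebraMap_eq_diagonal])
  have hpos : (A - algebraMap ℝ (Matrix V V ℝ) l).PosSemidef := by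
    rw [hB.posSemidef_iff_eigenvalues_nonneg]
    intro i
    have hi := hB.eigenvalues_mem_spectrum_real i
    rw [← spectrum.sub_singleton_eq, hA.spectrum_real_eq_range_eigenvalues] at hi
    obtain ⟨_, ⟨j, rfl⟩, _, rfl, h⟩ := hi
    have := hl j
    simp only [Pi.zero_apply]
    dsimp only at h
    linarith
  have := hpos.dotProduct_mulVec_nonneg x
  simpa [Matrix.sub_mulVec, Algebra.algebraMap_eq_smul_one, Matrix.smul_mulVec] using this

open Matrix in
theorem SimpleGraph.dotProduct_adjMatrix_mulVec_single_sub_single {V : Type*} [Fintype V]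
    [DecidableEq V] (G : SimpleGraph V) [DecidableRel G.Adj] {u v : V} (h : G.Adj u v) :
    (Pi.single u 1 - Pi.single v 1 : V → ℝ) ⬝ᵥ
      G.adjMatrix ℝ *ᵥ (Pi.single u 1 - Pi.single v 1) = -2 := by
  simp [Matrix.mulVec_sub, sub_dotProduct, h, h.symm]
  norm_num

/-- For vertices of colors `a` and `b`, the product of the weights `1 - k [color = i]` summed over
all `k` colors `i`. -/
theorem Fin.sum_one_sub_ite_mul_one_sub_ite {k : ℕ} (a b : Fin k) :
    ∑ i : Fin k, (1 - if a = i then (k : ℝ) else 0) * (1 - if b = i then (k : ℝ) else 0) =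
      -k + if a = b then (k : ℝ) ^ 2 else 0 := by
  have h (i : Fin k) : (1 - if a = i then (k : ℝ) else 0) * (1 - if b = i then (k : ℝ) else 0) =
      1 - (if a = i then (k : ℝ) else 0) - (if b = i then (k : ℝ) else 0) +
        if a = i then (if a = b then (k : ℝ) ^ 2 else 0) else 0 := by
    split_ifs <;> first | (subst_vars; contradiction) | ring
  simp only [h, Finset.sum_add_distrib, Finset.sum_sub_distrib, Finset.sum_ite_eq,
    Finset.mem_univ, if_true, Finset.sum_const, Finset.card_univ, Fintype.card_fin, nsmul_eq_mul]
  ring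

open Matrix in
/-- If the Rayleigh quotients of the adjacency matrix of a `k`-colored graph are bounded below by
`l`, then they are bounded above by `-l * (k - 1)`. -/
theorem SimpleGraph.Coloring.dotProduct_adjMatrix_mulVec_le {V : Type*} [Fintype V]
    {G : SimpleGraph V} [DecidableRel G.Adj] {k : ℕ} (c : G.Coloring (Fin k)) (hk : 0 < k)
    {l : ℝ} (hl : ∀ x : V → ℝ, l * (x ⬝ᵥ x) ≤ x ⬝ᵥ G.adjMatrix ℝ *ᵥ x) (x : V → ℝ) :
    x ⬝ᵥ G.adjMatrix ℝ *ᵥ x ≤ -l * (k - 1) * (x ⬝ᵥ x) := by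
  let w (i : Fin k) (u : V) : ℝ := 1 - if c u = i then (k : ℝ) else 0
  let y (i : Fin k) (u : V) : ℝ := x u * w i u
  have hw (u v : V) : ∑ i, w i u * w i v = -k + if c u = c v then (k : ℝ) ^ 2 else 0 :=
    Fin.sum_one_sub_ite_mul_one_sub_ite (c u) (c v)
  have hnorm : ∑ i, y i ⬝ᵥ y i = k * (k - 1) * (x ⬝ᵥ x) := by
    simp only [dotProduct]
    rw [Finset.sum_comm, Finset.mul_sum]
    refine Finset.sum_congr rfl fun u _ ↦ ?_
    calc ∑ i, y i u * y i u = x u * x u * ∑ i, w i u * w i u := by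
          rw [Finset.mul_sum]
          exact Finset.sum_congr rfl fun i _ ↦ by simp only [y]; ring
      _ = k * (k - 1) * (x u * x u) := by rw [hw, if_pos rfl]; ring
  have hquad : ∑ i, y i ⬝ᵥ G.adjMatrix ℝ *ᵥ y i = -k * (x ⬝ᵥ G.adjMatrix ℝ *ᵥ x) := by
    simp only [dotProduct, mulVec, Finset.mul_sum]
    rw [Finset.sum_comm]
    refine Finset.sum_congr rfl fun u _ ↦ ?_
    rw [Finset.sum_comm]
    refine Finset.sum_congr rfl fun v _ ↦ ?_
    calc ∑ i, y i u * (G.adjMatrix ℝ u v * y i v)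
        = x u * (G.adjMatrix ℝ u v * x v) * ∑ i, w i u * w i v := by
          rw [Finset.mul_sum]
          exact Finset.sum_congr rfl fun i _ ↦ by simp only [y]; ring
      _ = -k * (x u * (G.adjMatrix ℝ u v * x v)) := by
          by_cases h : G.Adj u v
          · rw [hw, if_neg (c.valid h)]; ring
          · simp [h]
  have hsum := Finset.sum_le_sum fun i (_ : i ∈ Finset.univ) ↦ hl (y i)
  rw [← Finset.mul_sum, hnorm, hquad] at hsum
  have hk' : (0 : ℝ) < k := by exact_mod_cast hk
  refine le_of_mul_le_mul_left ?_ hk'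
  linarith

/-- Hoffman's bound: let `G` be a finite simple graph on `n ≥ 2` vertices with
at least one edge, and let `λ₁ ≥ ⋯ ≥ λ_n` be the eigenvalues of its adjacency
matrix, so that `λ₁` is the largest and `λ_n` the smallest eigenvalue. Then
`λ_n < 0` and `χ(G) ≥ 1 - λ₁ / λ_n`. -/
theorem hoffman_bound
    {V : Type*} [Fintype V] [DecidableEq V] (G : SimpleGraph V)
    [DecidableRel G.Adj]
    (hcard : 2 ≤ Fintype.card V) (hE : G.edgeSet.Nonempty)
    (hA : (G.adjMatrix ℝ).IsHermitian)
    (lam₁ lamₙ : ℝ)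
    (h₁ : IsGreatest (Set.range hA.eigenvalues) lam₁)
    (hₙ : IsLeast (Set.range hA.eigenvalues) lamₙ) :
    lamₙ < 0 ∧ 1 - lam₁ / lamₙ ≤ (G.chromaticNumber.toNat : ℝ) := by
  have hR := hA.mul_dotProduct_le_of_le_eigenvalues fun i ↦ hₙ.2 ⟨i, rfl⟩
  obtain ⟨⟨u, v⟩, huv⟩ := hE
  have hadj : G.Adj u v := huv
  have hneg : lamₙ < 0 := by
    have h := hR (Pi.single u 1 - Pi.single v 1)
    rw [G.dotProduct_adjMatrix_mulVec_single_sub_single hadj] at h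
    by_contra! hn
    have := mul_nonneg hn (dotProduct_self_star_nonneg (Pi.single u 1 - Pi.single v 1 : V → ℝ))
    simp only [star_trivial] at this
    linarith
  refine ⟨hneg, ?_⟩
  have hcol : G.Colorable G.chromaticNumber.toNat :=
    SimpleGraph.colorable_of_chromaticNumber_ne_top
      (SimpleGraph.chromaticNumber_ne_top_iff_exists.2 ⟨_, G.colorable_of_fintype⟩)
  obtain ⟨c⟩ := hcol
  obtain ⟨j, rfl⟩ := h₁.1
  have hle := c.dotProduct_adjMatrix_mulVec_le (c u).pos hR (hA.eigenvectorBasis j).ofLp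
  rw [hA.mulVec_eigenvectorBasis, dotProduct_smul, smul_eq_mul] at hle
  have hx : 0 < (hA.eigenvectorBasis j).ofLp ⬝ᵥ (hA.eigenvectorBasis j).ofLp := by
    have := Matrix.dotProduct_self_star_pos_iff (v := (hA.eigenvectorBasis j).ofLp)
    rw [star_trivial] at this
    refine this.2 fun h ↦ hA.eigenvectorBasis.orthonormal.ne_zero j ?_
    ext i
    exact congrFun h i
  have hle' := le_of_mul_le_mul_right hle hx
  have : -(G.chromaticNumber.toNat - 1 : ℝ) ≤ hA.eigenvalues j / lamₙ := by
    rw [le_div_iff_of_neg hneg]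
    linarith
  linarith
end

section
/- Let G be a finite simple graph on n ≥ 1 vertices, let A be its adjacency matrix, and let λ₁ be the largest eigenvalue of A. Then λ₁ < n and χ(G) ≥ n / (n − λ₁) (the Edwards–Elphick bound). -/
open Finset in
/-- The quadratic form of the adjacency matrix of a graph with a `k`-coloring is at most
`1 - 1 / k` times the square of the `ℓ¹` norm. -/
theorem SimpleGraph.Coloring.card_mul_adjMatrix_quadForm_le
    {V : Type*} [Fintype V] (G : SimpleGraph V) [DecidableRel G.Adj] {k : ℕ}
    (C : G.Coloring (Fin k)) (x : V → ℝ) :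
    (k : ℝ) * ∑ i, x i * (G.adjMatrix ℝ).mulVec x i ≤ ((k : ℝ) - 1) * (∑ i, |x i|) ^ 2 := by
  set S : Fin k → ℝ := fun a => ∑ i with C i = a, |x i| with hS
  have hsum : ∑ a, S a = ∑ i, |x i| := sum_fiberwise univ C fun i => |x i|
  have hcauchy : (∑ i, |x i|) ^ 2 ≤ (k : ℝ) * ∑ a, S a ^ 2 := by
    rw [← hsum]
    simpa using sq_sum_le_card_mul_sum_sq (s := univ) (f := S)
  have hsq : ∑ a, S a ^ 2 = ∑ i, ∑ j, if C j = C i then |x i| * |x j| else 0 := by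
    rw [← sum_fiberwise univ C]
    refine sum_congr rfl fun a _ => ?_
    rw [sq, hS, sum_mul]
    refine sum_congr rfl fun i hi => ?_
    rw [mul_sum, sum_filter, (mem_filter.1 hi).2]
  have hquad : ∑ i, x i * (G.adjMatrix ℝ).mulVec x i ≤ (∑ i, |x i|) ^ 2 - ∑ a, S a ^ 2 := by
    rw [hsq, sq, sum_mul_sum, ← sum_sub_distrib]
    refine sum_le_sum fun i _ => ?_
    rw [← sum_sub_distrib, Matrix.mulVec, dotProduct, mul_sum]
    refine sum_le_sum fun j _ => ?_
    have habs : x i * x j ≤ |x i| * |x j| := (le_abs_self _).trans (abs_mul _ _).le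
    have hnonneg : 0 ≤ |x i| * |x j| := by positivity
    by_cases hadj : G.Adj i j
    · have hne : C j ≠ C i := (C.valid hadj).symm
      simpa [SimpleGraph.adjMatrix_apply, hadj, hne] using habs
    · by_cases hc : C j = C i <;> simp [SimpleGraph.adjMatrix_apply, hadj, hc, hnonneg]
  have := mul_le_mul_of_nonneg_left hquad (Nat.cast_nonneg (α := ℝ) k)
  linarith

open Finset in
/-- Every eigenvalue `μ` of the adjacency matrix of a `k`-colorable graph on `n` vertices
satisfies `k * μ ≤ (k - 1) * n`. -/
theorem SimpleGraph.Colorable.mul_eigenvalue_le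
    {V : Type*} [Fintype V] {G : SimpleGraph V} [DecidableRel G.Adj] {k : ℕ}
    (hk : 1 ≤ k) (hG : G.Colorable k) {x : V → ℝ} (hx : x ≠ 0) {μ : ℝ}
    (hμ : (G.adjMatrix ℝ).mulVec x = μ • x) :
    (k : ℝ) * μ ≤ ((k : ℝ) - 1) * Fintype.card V := by
  obtain ⟨C⟩ := hG
  have hpos : 0 < ∑ i, x i ^ 2 := by
    obtain ⟨i, hi⟩ := Function.ne_iff.1 hx
    exact sum_pos' (fun i _ => sq_nonneg _) ⟨i, mem_univ i, sq_pos_iff.2 hi⟩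
  have hquad := SimpleGraph.Coloring.card_mul_adjMatrix_quadForm_le G C x
  have heig : ∑ i, x i * (G.adjMatrix ℝ).mulVec x i = μ * ∑ i, x i ^ 2 := by
    rw [hμ, mul_sum]
    refine sum_congr rfl fun i _ => ?_
    rw [Pi.smul_apply, smul_eq_mul]
    ring
  have hcauchy : (∑ i, |x i|) ^ 2 ≤ (Fintype.card V : ℝ) * ∑ i, x i ^ 2 := by
    simpa using sq_sum_le_card_mul_sum_sq (s := univ) (f := fun i => |x i|)
  have hk' : (0 : ℝ) ≤ (k : ℝ) - 1 := sub_nonneg.2 (by exact_mod_cast hk)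
  refine le_of_mul_le_mul_right ?_ hpos
  rw [heig] at hquad
  have := mul_le_mul_of_nonneg_left hcauchy hk'
  linarith

/-- Edwards–Elphick bound: let `G` be a finite simple graph on `n ≥ 1`
vertices and let `λ₁` be the largest eigenvalue of its adjacency matrix. Then
`λ₁ < n` and `χ(G) ≥ n / (n - λ₁)`. -/
theorem edwards_elphick_bound
    {V : Type*} [Fintype V] [DecidableEq V] (G : SimpleGraph V)
    [DecidableRel G.Adj]
    (n : ℕ) (hn : Fintype.card V = n) (hn1 : 1 ≤ n)
    (hA : (G.adjMatrix ℝ).IsHermitian)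
    (lam₁ : ℝ) (h₁ : IsGreatest (Set.range hA.eigenvalues) lam₁) :
    lam₁ < n ∧ (n : ℝ) / ((n : ℝ) - lam₁) ≤ (G.chromaticNumber.toNat : ℝ) := by
  obtain ⟨⟨i, rfl⟩, -⟩ := h₁
  have hcol : G.Colorable G.chromaticNumber.toNat :=
    SimpleGraph.colorable_chromaticNumber G.colorable_of_fintype
  set k := G.chromaticNumber.toNat
  have hk : 1 ≤ k := by
    obtain ⟨C⟩ := hcol
    exact (Nat.zero_le _).trans_lt (C i).isLt
  have hne : (hA.eigenvectorBasis i).ofLp ≠ 0 := by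
    simpa using hA.eigenvectorBasis.orthonormal.ne_zero i
  have hbound := hcol.mul_eigenvalue_le hk hne (hA.mulVec_eigenvectorBasis i)
  rw [hn] at hbound
  have hk0 : (0 : ℝ) < k := by exact_mod_cast hk
  have hn0 : (0 : ℝ) < n := by exact_mod_cast hn1
  have hlt : hA.eigenvalues i < n := lt_of_mul_lt_mul_left (by linarith) hk0.le
  refine ⟨hlt, ?_⟩
  rw [div_le_iff₀ (sub_pos.2 hlt)]
  linarith
end

section
/- Let G be a finite simple graph with at least one edge, let A be its adjacency matrix, and let n⁺ and n⁻ denote the number of positive and negative eigenvalues of A, respectively (counted with multiplicity). Then n⁺ ≥ 1, n⁻ ≥ 1, and χ(G) ≥ 1 + max(n⁺/n⁻, n⁻/n⁺) (the Elphick–Wocjan inertia bound). -/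
open Finset in
/-- Let `B` be a real bilinear form diagonalized by the coordinates `c i` with diagonal entries
`l i`. If the identity is a sum of `n + 1` operators `D j` whose ranges are isotropic for `B`, then
the positive index of inertia is at most `n` times the negative one. -/
theorem card_pos_le_mul_card_neg_of_isotropic_decomposition
    {E ι : Type*} [AddCommGroup E] [Module ℝ E] [FiniteDimensional ℝ E] [Fintype ι]
    (hcard : Fintype.card ι = Module.finrank ℝ E)
    (B : E →ₗ[ℝ] E →ₗ[ℝ] ℝ) (c : ι → E →ₗ[ℝ] ℝ) (l : ι → ℝ)
    (hB : ∀ x, B x x = ∑ i, l i * (c i x) ^ 2)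
    (hc : ∀ x, (∀ i, c i x = 0) → x = 0)
    (n : ℕ) (D : Fin (n + 1) → E →ₗ[ℝ] E)
    (hD : ∀ x, ∑ j, D j x = x) (hBD : ∀ j x, B (D j x) (D j x) = 0) :
    {i | 0 < l i}.ncard ≤ n * {i | l i < 0}.ncard := by
  classical
  by_contra! hlt
  let U : Fin (n + 1) → E →ₗ[ℝ] E := fun j => D j - ((n : ℝ) + 1)⁻¹ • LinearMap.id
  have hn : (n : ℝ) + 1 ≠ 0 := by positivity
  have hUsum : ∀ x, ∑ j, U j x = 0 := by
    intro x
    simp only [U, LinearMap.sub_apply, LinearMap.smul_apply, LinearMap.id_apply, sum_sub_distrib,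
      hD, sum_const, card_univ, Fintype.card_fin]
    rw [← Nat.cast_smul_eq_nsmul ℝ, smul_smul]
    push_cast
    rw [mul_inv_cancel₀ hn, one_smul, sub_self]
  let T : E →ₗ[ℝ] ({i // ¬ 0 < l i} → ℝ) × (Fin n × {i // l i < 0} → ℝ) :=
    (LinearMap.pi fun i => c i.1).prod (LinearMap.pi fun p => c p.2.1 ∘ₗ U p.1.succ)
  have hdim : Module.finrank ℝ (({i // ¬ 0 < l i} → ℝ) × (Fin n × {i // l i < 0} → ℝ)) <
      Module.finrank ℝ E := by
    have h1 : {i | 0 < l i}.ncard = Fintype.card {i // 0 < l i} := by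
      rw [← Nat.card_coe_set_eq, Nat.card_eq_fintype_card]; rfl
    have h2 : {i | l i < 0}.ncard = Fintype.card {i // l i < 0} := by
      rw [← Nat.card_coe_set_eq, Nat.card_eq_fintype_card]; rfl
    have h3 := Fintype.card_subtype_compl (fun i => 0 < l i)
    have h4 := Fintype.card_subtype_le (fun i => 0 < l i)
    rw [Module.finrank_prod, Module.finrank_fintype_fun_eq_card,
      Module.finrank_fintype_fun_eq_card, Fintype.card_prod, Fintype.card_fin, ← hcard]
    rw [h1, h2] at hlt
    omega
  obtain ⟨x, hxT, hx0⟩ :=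
    (Submodule.ne_bot_iff _).1 (LinearMap.ker_ne_bot_of_finrank_lt hdim (f := T))
  have hTx : T x = 0 := hxT
  have hpos : ∀ i, ¬ 0 < l i → c i x = 0 := fun i hi => congrFun (congrArg Prod.fst hTx) ⟨i, hi⟩
  have hneg : ∀ j i, l i < 0 → c i (U j x) = 0 := by
    intro j i hi
    have hsucc : ∀ k : Fin n, c i (U k.succ x) = 0 := fun k =>
      congrFun (congrArg Prod.snd hTx) (k, ⟨i, hi⟩)
    refine Fin.cases ?_ hsucc j
    have h := congrArg (c i) (hUsum x)
    simpa [Fin.sum_univ_succ, hsucc] using h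
  have hBx : 0 < B x x := by
    have hx : ∃ i, c i x ≠ 0 := by
      by_contra! h
      exact hx0 (hc x h)
    obtain ⟨i, hi⟩ := hx
    rw [hB]
    refine sum_pos' (fun k _ => ?_) ⟨i, mem_univ i, ?_⟩
    · by_cases hk : 0 < l k
      · positivity
      · simp [hpos k hk]
    · have : 0 < l i := by
        by_contra h
        exact hi (hpos i h)
      positivity
  have hBU : ∀ j, 0 ≤ B (U j x) (U j x) := by
    intro j
    rw [hB]
    refine sum_nonneg fun k _ => ?_
    by_cases hk : l k < 0
    · simp [hneg j k hk]
    · have := not_lt.1 hk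
      positivity
  have hsum : ∑ j, B (U j x) (U j x) = -(((n : ℝ) + 1)⁻¹ * B x x) := by
    have hterm : ∀ j, B (U j x) (U j x) =
        -((n : ℝ) + 1)⁻¹ * B (D j x) x - ((n : ℝ) + 1)⁻¹ * B x (U j x) := by
      intro j
      simp only [U, LinearMap.sub_apply, LinearMap.smul_apply, LinearMap.id_apply, map_sub,
        map_smul, hBD, smul_eq_mul]
      ring
    rw [sum_congr rfl fun j _ => hterm j, sum_sub_distrib, ← mul_sum, ← mul_sum, ← map_sum, hUsum,
      ← LinearMap.sum_apply, ← map_sum, hD, map_zero]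
    ring
  have h1 := sum_nonneg fun j (_ : j ∈ univ) => hBU j
  have h2 : 0 < ((n : ℝ) + 1)⁻¹ * B x x := by positivity
  linarith

/-- The quadratic form of a real Hermitian matrix in the coordinates of an eigenbasis. -/
theorem Matrix.IsHermitian.dotProduct_mulVec_eq_sum_eigenvalues
    {V : Type*} [Fintype V] [DecidableEq V] {A : Matrix V V ℝ} (hA : A.IsHermitian) (x : V → ℝ) :
    x ⬝ᵥ A.mulVec x =
      ∑ i, hA.eigenvalues i * ((star (hA.eigenvectorUnitary : Matrix V V ℝ)).mulVec x i) ^ 2 := by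
  conv_lhs => rw [hA.spectral_theorem]
  rw [Unitary.conjStarAlgAut_apply, ← Matrix.mulVec_mulVec, ← Matrix.mulVec_mulVec,
    Matrix.dotProduct_mulVec, ← Matrix.mulVec_transpose]
  simp only [dotProduct, Matrix.mulVec_diagonal, Function.comp_apply, RCLike.ofReal_real_eq_id,
    id_eq, Matrix.star_eq_conjTranspose, Matrix.conjTranspose_eq_transpose_of_trivial]
  exact Finset.sum_congr rfl fun i _ => by ring

/-- The adjacency form of a graph vanishes on vectors supported on a color class. -/
theorem SimpleGraph.Coloring.dotProduct_adjMatrix_mulVec_colorClass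
    {V α : Type*} [Fintype V] [DecidableEq α] {G : SimpleGraph V} [DecidableRel G.Adj]
    (C : G.Coloring α) (j : α) (x : V → ℝ) :
    (fun v => if C v = j then x v else 0) ⬝ᵥ
      (G.adjMatrix ℝ).mulVec (fun v => if C v = j then x v else 0) = 0 := by
  refine Finset.sum_eq_zero fun v _ => ?_
  by_cases hv : C v = j
  · have : (G.adjMatrix ℝ).mulVec (fun v => if C v = j then x v else 0) v = 0 := by
      refine Finset.sum_eq_zero fun w _ => ?_
      by_cases hw : G.Adj v w
      · have : C w ≠ j := fun h => C.valid hw (hv.trans h.symm)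
        simp [this]
      · simp [hw]
    rw [this, mul_zero]
  · simp [hv]

/-- In a graph colorable with `n + 1` colors, the numbers of positive and of negative adjacency
eigenvalues are each at most `n` times the other. -/
theorem SimpleGraph.Coloring.ncard_eigenvalues_le
    {V : Type*} [Fintype V] [DecidableEq V] {G : SimpleGraph V} [DecidableRel G.Adj]
    (hA : (G.adjMatrix ℝ).IsHermitian) {n : ℕ} (C : G.Coloring (Fin (n + 1))) :
    {i | 0 < hA.eigenvalues i}.ncard ≤ n * {i | hA.eigenvalues i < 0}.ncard ∧
      {i | hA.eigenvalues i < 0}.ncard ≤ n * {i | 0 < hA.eigenvalues i}.ncard := by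
  let W : Matrix V V ℝ := star (hA.eigenvectorUnitary : Matrix V V ℝ)
  let B : (V → ℝ) →ₗ[ℝ] (V → ℝ) →ₗ[ℝ] ℝ := Matrix.toLinearMap₂' ℝ (G.adjMatrix ℝ)
  let c : V → (V → ℝ) →ₗ[ℝ] ℝ := fun i => LinearMap.proj i ∘ₗ W.mulVecLin
  let D : Fin (n + 1) → (V → ℝ) →ₗ[ℝ] (V → ℝ) := fun j =>
    LinearMap.pi fun v => if C v = j then LinearMap.proj v else 0
  have hDapp : ∀ j x, D j x = fun v => if C v = j then x v else 0 := by
    intro j x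
    ext v
    by_cases h : C v = j <;> simp [D, h]
  have hcard : Fintype.card V = Module.finrank ℝ (V → ℝ) := by simp
  have hB : ∀ x, B x x = ∑ i, hA.eigenvalues i * (c i x) ^ 2 := fun x =>
    (Matrix.toLinearMap₂'_apply' _ x x).trans (hA.dotProduct_mulVec_eq_sum_eigenvalues x)
  have hc : ∀ x, (∀ i, c i x = 0) → x = 0 := by
    intro x hx
    have hWx : W.mulVec x = 0 := funext hx
    have hUW : (hA.eigenvectorUnitary : Matrix V V ℝ) * W = 1 :=
      Unitary.coe_mul_star_self hA.eigenvectorUnitary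
    rw [← Matrix.one_mulVec x, ← hUW, ← Matrix.mulVec_mulVec, hWx, Matrix.mulVec_zero]
  have hD : ∀ x, ∑ j, D j x = x := by
    intro x
    ext v
    simp [hDapp, Finset.sum_apply]
  have hBD : ∀ j x, B (D j x) (D j x) = 0 := by
    intro j x
    rw [hDapp]
    exact (Matrix.toLinearMap₂'_apply' _ _ _).trans
      (C.dotProduct_adjMatrix_mulVec_colorClass j x)
  refine ⟨card_pos_le_mul_card_neg_of_isotropic_decomposition hcard B c _ hB hc n D hD hBD, ?_⟩
  simpa using card_pos_le_mul_card_neg_of_isotropic_decomposition hcard (-B) c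
    (fun i => -hA.eigenvalues i) (by simp [hB]) hc n D hD (by simp [hBD])


/-- Elphick–Wocjan inertia bound: let `G` be a finite simple graph with at
least one edge, and let `n⁺` and `n⁻` be the numbers of positive and negative
eigenvalues (with multiplicity) of its adjacency matrix. Then `n⁺ ≥ 1`,
`n⁻ ≥ 1`, and `χ(G) ≥ 1 + max(n⁺/n⁻, n⁻/n⁺)`. -/
theorem elphick_wocjan_bound
    {V : Type*} [Fintype V] [DecidableEq V] (G : SimpleGraph V)
    [DecidableRel G.Adj]
    (hE : G.edgeSet.Nonempty)
    (hA : (G.adjMatrix ℝ).IsHermitian)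
    (np nm : ℕ)
    (hnp : np = {i : V | 0 < hA.eigenvalues i}.ncard)
    (hnm : nm = {i : V | hA.eigenvalues i < 0}.ncard) :
    1 ≤ np ∧ 1 ≤ nm ∧
      1 + max ((np : ℝ) / (nm : ℝ)) ((nm : ℝ) / (np : ℝ)) ≤
        (G.chromaticNumber.toNat : ℝ) := by
  obtain ⟨e, he⟩ := hE
  induction e with
  | h u v =>
  have huv : G.Adj u v := he
  have hcol : G.Colorable G.chromaticNumber.toNat :=
    SimpleGraph.colorable_chromaticNumber G.colorable_of_fintype
  obtain ⟨n, hn⟩ : ∃ n, G.chromaticNumber.toNat = n + 1 := by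
    refine Nat.exists_eq_succ_of_ne_zero fun h => ?_
    rw [h] at hcol
    exact (hcol.some u).elim0
  rw [hn] at hcol
  obtain ⟨hpm, hmp⟩ := hcol.some.ncard_eigenvalues_le hA
  rw [← hnp, ← hnm] at hpm hmp
  have hor : np ≠ 0 ∨ nm ≠ 0 := by
    by_contra! h
    have hp : {i : V | 0 < hA.eigenvalues i} = ∅ := (Set.ncard_eq_zero).1 (hnp.symm.trans h.1)
    have hm : {i : V | hA.eigenvalues i < 0} = ∅ := (Set.ncard_eq_zero).1 (hnm.symm.trans h.2)
    have hzero : hA.eigenvalues = 0 := funext fun i =>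
      le_antisymm (not_lt.1 fun hi => hp.subset hi) (not_lt.1 fun hi => hm.subset hi)
    have hA0 : G.adjMatrix ℝ = 0 := hA.eigenvalues_eq_zero_iff.1 hzero
    simpa [huv] using congrFun (congrFun hA0 u) v
  have hp : np ≠ 0 := fun h => by rw [h] at hmp hor; simp at hmp hor; exact hor hmp
  have hm : nm ≠ 0 := fun h => by rw [h] at hpm hor; simp at hpm hor; exact hor hpm
  refine ⟨Nat.one_le_iff_ne_zero.2 hp, Nat.one_le_iff_ne_zero.2 hm, ?_⟩
  have hp' : (0 : ℝ) < np := by positivity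
  have hm' : (0 : ℝ) < nm := by positivity
  have hmax : max ((np : ℝ) / nm) ((nm : ℝ) / np) ≤ n :=
    max_le ((div_le_iff₀ hm').2 (by exact_mod_cast hpm))
      ((div_le_iff₀ hp').2 (by exact_mod_cast hmp))
  rw [hn]
  push_cast
  linarith
end
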